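/- Let δ be a triple derivation on a C*-algebra A and let e ∈ A be a tripotent. Then: (i) P₀(e)(δ(e)) = 0, i.e. δ(e) − e e* δ(e) − δ(e) e* e + e e* δ(e) e* e = 0; and (ii) e δ(e)* e = − e e* δ(e) e* e, i.e. the Peirce-2 component P₂(e)(δ(e)) is a skew-symmetric element of the Peirce 2-space A₂(e) with respect to the involution x ↦ e x* e. -/

import Mathlib

variable {A : Type*} [NonUnitalNormedRing A] [StarRing A] [CStarRing A]
  [NormedSpace ℂ A] [IsScalarTower ℂ A A] [SMulCommClass ℂ A A]
  [StarModule ℂ A] [CompleteSpace A]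

/-- The triple product `{x,y,z} = (1/2)(x y* z + z y* x)` on a C*-algebra. -/
noncomputable def tp (x y z : A) : A := (2⁻¹ : ℂ) • (x * star y * z + z * star y * x)

/-- A triple derivation. -/
def IsTripleDerivation (δ : A → A) : Prop :=
  ∀ a b c : A, δ (tp a b c) = tp (δ a) b c + tp a (δ b) c + tp a b (δ c)

/-- Applying a triple derivation to `{e,e,e} = e`. -/
theorem IsTripleDerivation.apply_tripotent {δ : A → A} (hδ : IsTripleDerivation δ)
    {e : A} (he : e * star e * e = e) :
    δ e = δ e * star e * e + e * star e * δ e + e * star (δ e) * e := by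
  have h_cube : tp e e e = e := by
    rw [tp, he]
    module
  have h := hδ e e e
  rw [h_cube] at h
  refine h.trans ?_
  simp only [tp]
  module

/-- for a triple derivation `δ` and a tripotent `e`, the Peirce-0
component of `δ e` vanishes and the Peirce-2 component of `δ e` is skew-symmetric
in the Peirce 2-space `A₂(e)` (with involution `x ↦ e x* e`). -/
theorem stmt11 (δ : A →ₗ[ℂ] A) (hδ : IsTripleDerivation (δ : A → A))
    (e : A) (he : e * star e * e = e) :
    (δ e - e * star e * δ e - δ e * star e * e + e * star e * δ e * star e * e = 0) ∧
    (e * star (δ e) * e = -(e * star e * δ e * star e * e)) := by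
  have h := hδ.apply_tripotent he
  generalize δ e = d at h ⊢
  have he_left (x : A) : e * (star e * (e * x)) = e * x := by
    rw [← mul_assoc, ← mul_assoc, he]
  have he_right : e * (star e * e) = e := by rw [← mul_assoc, he]
  have h_skew : e * star d * e = -(e * star e * d * star e * e) := by
    have h_peirce := congrArg (fun x ↦ e * star e * x * star e * e) h
    simp only [mul_add, add_mul, mul_assoc, he_left, he_right] at h_peirce ⊢
    rw [add_assoc, left_eq_add] at h_peirce
    exact eq_neg_of_add_eq_zero_right h_peirce
  refine ⟨?_, h_skew⟩
  rw [h_skew] at h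
  nth_rewrite 1 [h]
  abel
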